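/- Let c > 0 and define u : [0,∞) → ℝ by u(0) = 1 and, for t > 0, u(t) = (2/(π c t)) ∫_0^{π/2} sin(2ct·sin θ) sin θ dθ. Then u is continuous on [0,∞), differentiable on (0,∞), and for every t > 0 it satisfies u'(t) = -c² ∫_0^t u(t-s) u(s) ds. (That is, the function J₁(2ct)/(ct) satisfies the real-valued convolution identity underlying the Bethe lattice Dyson equation.) -/

import Mathlib

open Real MeasureTheory intervalIntegral

/-- Wallis' formula for even powers of the sine on a quarter period. -/
lemma integral_sin_pow_even_quarter (n : ℕ) :
    ∫ θ in (0:ℝ)..(π / 2), Real.sin θ ^ (2 * n) = π / 2 * (n.centralBinom / 4 ^ n) := by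
  induction n with
  | zero => simp
  | succ k ih =>
    have h : ((k : ℝ) + 1) * (k + 1).centralBinom = 2 * (2 * k + 1) * k.centralBinom := by
      exact_mod_cast Nat.succ_mul_centralBinom_succ k
    have hk : (k : ℝ) + 1 ≠ 0 := by positivity
    rw [show 2 * (k + 1) = 2 * k + 2 by ring, integral_sin_pow, ih]
    rw [mul_comm, ← eq_div_iff hk] at h
    simp only [h, sin_zero, cos_zero, sin_pi_div_two, cos_pi_div_two]
    push_cast
    field_simp
    ring

lemma centralBinom_succ_eq_catalan (n : ℕ) :
    ((n + 1).centralBinom : ℝ) = 2 * (2 * n + 1) * catalan n := by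
  have h : ((n : ℝ) + 1) * (n + 1).centralBinom = 2 * (2 * n + 1) * n.centralBinom := by
    exact_mod_cast Nat.succ_mul_centralBinom_succ n
  have h' : ((n : ℝ) + 1) * catalan n = n.centralBinom := by
    exact_mod_cast succ_mul_catalan_eq_centralBinom n
  have hn : (n : ℝ) + 1 ≠ 0 := by positivity
  apply mul_left_cancel₀ hn
  rw [h, ← h']
  ring

lemma catalan_le_four_pow (n : ℕ) : catalan n ≤ 4 ^ n := by
  refine le_trans ?_ (Nat.centralBinom_le_four_pow n)
  rw [← succ_mul_catalan_eq_centralBinom]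
  exact Nat.le_mul_of_pos_left _ n.succ_pos

/-- The sine series integrated term by term against `sin` on a quarter period. -/
lemma hasSum_integral_sin_mul_sin (x : ℝ) :
    HasSum (fun n : ℕ => (-1) ^ n * x ^ (2 * n + 1) / (2 * n + 1).factorial *
        (π / 2 * ((n + 1).centralBinom / 4 ^ (n + 1))))
      (∫ θ in (0:ℝ)..(π / 2), Real.sin (x * Real.sin θ) * Real.sin θ) := by
  have hs : Summable fun n : ℕ => |x| ^ (2 * n + 1) / (2 * n + 1).factorial :=
    (Real.summable_pow_div_factorial |x|).comp_injective (i := fun n : ℕ => 2 * n + 1)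
      fun a b h => by simpa using h
  have key := intervalIntegral.hasSum_integral_of_dominated_convergence
    (μ := volume) (a := 0) (b := π / 2)
    (F := fun (n : ℕ) θ => (-1) ^ n * x ^ (2 * n + 1) / (2 * n + 1).factorial *
      Real.sin θ ^ (2 * (n + 1)))
    (f := fun θ => Real.sin (x * Real.sin θ) * Real.sin θ)
    (fun n _ => |x| ^ (2 * n + 1) / (2 * n + 1).factorial)
    (fun n => by
      apply Continuous.aestronglyMeasurable
      fun_prop)
    (fun n => by
      refine .of_forall fun θ _ => ?_
      rw [norm_mul, norm_div, norm_mul, norm_pow, norm_pow, norm_pow]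
      simp only [norm_neg, norm_one, one_pow, one_mul, Real.norm_eq_abs, Nat.abs_cast]
      exact mul_le_of_le_one_right (by positivity)
        (pow_le_one₀ (abs_nonneg _) (abs_sin_le_one θ)))
    (.of_forall fun _ _ => hs) intervalIntegrable_const
    (.of_forall fun θ _ => by
      convert! (Real.hasSum_sin (x * Real.sin θ)).mul_right (Real.sin θ) using 2 with n
      ring)
  simpa only [intervalIntegral.integral_const_mul, integral_sin_pow_even_quarter] using key

/-- The Beta integral with integer parameters, scaled to `[0, t]`. -/
lemma integral_sub_pow_mul_pow (t : ℝ) (i j : ℕ) :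
    ∫ s in (0:ℝ)..t, (t - s) ^ i / i.factorial * (s ^ j / j.factorial) =
      t ^ (i + j + 1) / (i + j + 1).factorial := by
  induction i generalizing j with
  | zero =>
    simp only [pow_zero, Nat.factorial_zero, Nat.cast_one, div_one, one_mul,
      intervalIntegral.integral_div, integral_pow, zero_add, Nat.factorial_succ]
    push_cast
    have := Nat.factorial_ne_zero j
    field_simp
    simp
  | succ i ih =>
    have hd : ∀ s : ℝ, HasDerivAt
        (fun s => (t - s) ^ (i + 1) / (i + 1).factorial * (s ^ (j + 1) / (j + 1).factorial))
        ((t - s) ^ (i + 1) / (i + 1).factorial * (s ^ j / j.factorial) -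
          (t - s) ^ i / i.factorial * (s ^ (j + 1) / (j + 1).factorial)) s := by
      intro s
      have h1 : HasDerivAt (fun s : ℝ => (t - s) ^ (i + 1) / (i + 1).factorial)
          (((i + 1 : ℕ) : ℝ) * (t - s) ^ i * (-1) / (i + 1).factorial) s := by
        simpa using (((hasDerivAt_id s).const_sub t).pow (i + 1)).div_const
          ((i + 1).factorial : ℝ)
      have h2 : HasDerivAt (fun s : ℝ => s ^ (j + 1) / (j + 1).factorial)
          (((j + 1 : ℕ) : ℝ) * s ^ j / (j + 1).factorial) s := by
        simpa using (hasDerivAt_pow (j + 1) s).div_const ((j + 1).factorial : ℝ)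
      convert! h1.mul h2 using 1
      simp only [Nat.factorial_succ, Nat.cast_mul]
      have := Nat.factorial_ne_zero j
      have := Nat.factorial_ne_zero i
      field_simp
      ring
    have hi : ∀ k l : ℕ, IntervalIntegrable
        (fun s : ℝ => (t - s) ^ k / k.factorial * (s ^ l / l.factorial)) volume 0 t :=
      fun k l => Continuous.intervalIntegrable (by fun_prop) 0 t
    have h := intervalIntegral.integral_eq_sub_of_hasDerivAt (fun s _ => hd s)
      ((hi (i + 1) j).sub (hi i (j + 1)))
    rw [intervalIntegral.integral_sub (hi _ _) (hi _ _), ih (j + 1)] at h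
    simp only [sub_self, ne_eq, Nat.add_eq_zero_iff, one_ne_zero, and_false, not_false_eq_true,
      zero_pow, zero_div, zero_mul, mul_zero] at h
    rw [sub_eq_zero.1 h, show i + (j + 1) + 1 = i + 1 + j + 1 by ring]

/-- The even exponential generating function of `a`. -/
noncomputable def evenEGF (a : ℕ → ℝ) (t : ℝ) : ℝ :=
  ∑' n : ℕ, a n * (t ^ (2 * n) / (2 * n).factorial)

lemma summable_even_pow_div_factorial (x : ℝ) :
    Summable fun n : ℕ => x ^ (2 * n) / (2 * n).factorial :=
  (Real.summable_pow_div_factorial x).comp_injective (i := fun n : ℕ => 2 * n)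
    fun a b h => by simpa using h

lemma norm_evenEGF_term_le {a : ℕ → ℝ} {M : ℝ} (ha : ∀ n, |a n| ≤ M ^ (2 * n))
    {t R : ℝ} (ht : |t| ≤ R) (n : ℕ) :
    ‖a n * (t ^ (2 * n) / (2 * n).factorial)‖ ≤ (M * R) ^ (2 * n) / (2 * n).factorial := by
  rw [norm_mul, norm_div, norm_pow, Real.norm_eq_abs, Real.norm_eq_abs, Real.norm_eq_abs,
    Nat.abs_cast, mul_pow, mul_div_assoc]
  have : 0 ≤ M ^ (2 * n) := (abs_nonneg _).trans (ha n)
  gcongr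
  exact ha n

lemma summable_norm_evenEGF {a : ℕ → ℝ} {M : ℝ} (ha : ∀ n, |a n| ≤ M ^ (2 * n)) (t : ℝ) :
    Summable fun n : ℕ => ‖a n * (t ^ (2 * n) / (2 * n).factorial)‖ :=
  .of_nonneg_of_le (fun _ => norm_nonneg _) (norm_evenEGF_term_le ha le_rfl)
    (summable_even_pow_div_factorial _)

lemma hasDerivAt_evenEGF {a : ℕ → ℝ} {M : ℝ} (hM : 0 ≤ M) (ha : ∀ n, |a n| ≤ M ^ (2 * n))
    (t : ℝ) :
    HasDerivAt (evenEGF a)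
      (∑' n : ℕ, a (n + 1) * (t ^ (2 * n + 1) / (2 * n + 1).factorial)) t := by
  have hF : evenEGF a = fun t => a 0 +
      ∑' n : ℕ, a (n + 1) * (t ^ (2 * (n + 1)) / (2 * (n + 1)).factorial) := by
    funext t
    rw [evenEGF, (summable_norm_evenEGF ha t).of_norm.tsum_eq_zero_add]
    simp
  rw [hF]
  refine HasDerivAt.const_add _ ?_
  set R := |t| + 1
  have hR : 0 ≤ R := by positivity
  have hs : Summable fun n : ℕ => M * ((M * R) ^ (2 * n + 1) / (2 * n + 1).factorial) :=
    ((Real.summable_pow_div_factorial (M * R)).comp_injective (i := fun n : ℕ => 2 * n + 1)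
      fun a b h => by simpa using h).mul_left M
  refine hasDerivAt_tsum_of_isPreconnected (t := Metric.ball 0 R) (y₀ := t)
    (g := fun (n : ℕ) (t : ℝ) => a (n + 1) * (t ^ (2 * (n + 1)) / (2 * (n + 1)).factorial))
    (g' := fun (n : ℕ) (t : ℝ) => a (n + 1) * (t ^ (2 * n + 1) / (2 * n + 1).factorial))
    hs Metric.isOpen_ball
    (convex_ball 0 R).isPreconnected ?_ ?_ ?_ ?_ ?_
  · intro n y _
    have h := ((hasDerivAt_pow (2 * n + 1 + 1) y).div_const
      ((2 * n + 1 + 1).factorial : ℝ)).const_mul (a (n + 1))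
    convert! h using 1
    rw [Nat.factorial_succ (2 * n + 1)]
    have := Nat.factorial_ne_zero (2 * n + 1)
    push_cast
    field_simp
  · intro n y hy
    have hy' : |y| ≤ R := by simpa using (mem_ball_zero_iff.1 hy).le
    rw [norm_mul, norm_div, norm_pow, Real.norm_eq_abs, Real.norm_eq_abs, Real.norm_eq_abs,
      Nat.abs_cast]
    calc |a (n + 1)| * (|y| ^ (2 * n + 1) / (2 * n + 1).factorial)
        ≤ M ^ (2 * (n + 1)) * (R ^ (2 * n + 1) / (2 * n + 1).factorial) := by
          gcongr
          exact ha _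
      _ = M * ((M * R) ^ (2 * n + 1) / (2 * n + 1).factorial) := by
          rw [mul_pow]
          ring
  · simp [R]
  · exact ((summable_nat_add_iff 1).2 (summable_norm_evenEGF ha t)).of_norm
  · simp [R]

/-- The self-convolution of an even exponential generating function. -/
lemma hasSum_integral_evenEGF_mul {a : ℕ → ℝ} {M : ℝ} (ha : ∀ n, |a n| ≤ M ^ (2 * n))
    {t : ℝ} (ht : 0 ≤ t) :
    HasSum (fun n : ℕ => (∑ p ∈ Finset.HasAntidiagonal.antidiagonal n, a p.1 * a p.2) *
        (t ^ (2 * n + 1) / (2 * n + 1).factorial))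
      (∫ s in (0:ℝ)..t, evenEGF a (t - s) * evenEGF a s) := by
  have hb : Summable fun n : ℕ => ‖(M * t) ^ (2 * n) / ((2 * n).factorial : ℝ)‖ :=
    (summable_even_pow_div_factorial _).norm
  have key := intervalIntegral.hasSum_integral_of_dominated_convergence
    (μ := volume) (a := 0) (b := t)
    (F := fun (n : ℕ) s => ∑ p ∈ Finset.HasAntidiagonal.antidiagonal n,
      a p.1 * ((t - s) ^ (2 * p.1) / (2 * p.1).factorial) *
        (a p.2 * (s ^ (2 * p.2) / (2 * p.2).factorial)))
    (f := fun s => evenEGF a (t - s) * evenEGF a s)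
    (fun n _ => ∑ p ∈ Finset.HasAntidiagonal.antidiagonal n,
      (M * t) ^ (2 * p.1) / (2 * p.1).factorial * ((M * t) ^ (2 * p.2) / (2 * p.2).factorial))
    (fun n => by
      apply Continuous.aestronglyMeasurable
      fun_prop)
    (fun n => by
      refine .of_forall fun s hs => ?_
      rw [Set.uIoc_of_le ht] at hs
      have h1 : |t - s| ≤ t := by rw [abs_le]; constructor <;> linarith [hs.1, hs.2]
      have h2 : |s| ≤ t := by rw [abs_le]; constructor <;> linarith [hs.1, hs.2]
      refine norm_sum_le_of_le _ fun p _ => ?_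
      rw [norm_mul]
      exact mul_le_mul (norm_evenEGF_term_le ha h1 _) (norm_evenEGF_term_le ha h2 _)
        (norm_nonneg _) ((norm_nonneg _).trans (norm_evenEGF_term_le ha h1 _)))
    (.of_forall fun _ _ =>
      (summable_norm_sum_mul_antidiagonal_of_summable_norm hb hb).of_norm)
    intervalIntegrable_const
    (.of_forall fun s _ => by
      have h1 := summable_norm_evenEGF ha (t - s)
      have h2 := summable_norm_evenEGF ha s
      rw [evenEGF, evenEGF, tsum_mul_tsum_eq_tsum_sum_antidiagonal_of_summable_norm h1 h2]
      exact (summable_norm_sum_mul_antidiagonal_of_summable_norm h1 h2).of_norm.hasSum)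
  convert! key using 2 with n
  rw [intervalIntegral.integral_finsetSum
    fun p _ => Continuous.intervalIntegrable (by fun_prop) 0 t, Finset.sum_mul]
  refine Finset.sum_congr rfl fun p hp => ?_
  rw [← Finset.HasAntidiagonal.mem_antidiagonal.1 hp, show 2 * (p.1 + p.2) + 1 = 2 * p.1 + 2 * p.2 + 1 by ring,
    ← integral_sub_pow_mul_pow, ← intervalIntegral.integral_const_mul]
  congr 1
  funext s
  ring

/-- The signed Catalan numbers whose even generating function is `J₁(2ct)/(ct)`. -/
noncomputable def besselCoeff (c : ℝ) (n : ℕ) : ℝ := (-1) ^ n * catalan n * c ^ (2 * n)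

lemma abs_besselCoeff_le {c : ℝ} (hc : 0 ≤ c) (n : ℕ) :
    |besselCoeff c n| ≤ (2 * c) ^ (2 * n) := by
  have h : (catalan n : ℝ) ≤ 4 ^ n := by exact_mod_cast catalan_le_four_pow n
  rw [besselCoeff, abs_mul, abs_mul, abs_pow, abs_neg, abs_one, one_pow, one_mul, Nat.abs_cast,
    abs_of_nonneg (by positivity), mul_pow, pow_mul 2 2 n]
  norm_num
  gcongr

lemma besselCoeff_succ (c : ℝ) (n : ℕ) :
    besselCoeff c (n + 1) =
      -c ^ 2 * ∑ p ∈ Finset.HasAntidiagonal.antidiagonal n, besselCoeff c p.1 * besselCoeff c p.2 := by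
  have h : ∀ p ∈ Finset.HasAntidiagonal.antidiagonal n, besselCoeff c p.1 * besselCoeff c p.2 =
      (-1) ^ n * c ^ (2 * n) * (catalan p.1 * catalan p.2 : ℝ) := by
    intro p hp
    rw [← Finset.HasAntidiagonal.mem_antidiagonal.1 hp, besselCoeff, besselCoeff]
    ring
  rw [Finset.sum_congr rfl h, ← Finset.mul_sum, besselCoeff, catalan_succ']
  push_cast
  ring

lemma evenEGF_besselCoeff {c t : ℝ} (hc : 0 < c) (ht : 0 < t) :
    (2 / (π * c * t)) * ∫ θ in (0:ℝ)..(π / 2), Real.sin (2 * c * t * Real.sin θ) * Real.sin θ =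
      evenEGF (besselCoeff c) t := by
  rw [evenEGF, ← ((hasSum_integral_sin_mul_sin (2 * c * t)).mul_left _).tsum_eq]
  congr 1
  funext n
  have := Nat.factorial_ne_zero (2 * n)
  have h4 : (4 : ℝ) ^ n = 2 ^ (2 * n) := by rw [pow_mul]; norm_num
  rw [centralBinom_succ_eq_catalan, besselCoeff, Nat.factorial_succ, pow_succ 4 n, h4]
  push_cast
  field_simp
  ring

theorem bessel_ratio_convolution_identity (c : ℝ) (hc : 0 < c) (u : ℝ → ℝ)
    (hu0 : u 0 = 1)
    (hut : ∀ t : ℝ, 0 < t →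
      u t = (2 / (π * c * t)) *
        ∫ θ in (0:ℝ)..(π/2), Real.sin (2 * c * t * Real.sin θ) * Real.sin θ) :
    ContinuousOn u (Set.Ici 0) ∧
    (∀ t : ℝ, 0 < t → DifferentiableAt ℝ u t) ∧
    (∀ t : ℝ, 0 < t →
      deriv u t = -c^2 * ∫ s in (0:ℝ)..t, u (t - s) * u s) := by
  have ha := abs_besselCoeff_le hc.le
  have hd := hasDerivAt_evenEGF (by positivity : 0 ≤ 2 * c) ha
  have hu : Set.EqOn u (evenEGF (besselCoeff c)) (Set.Ici 0) := by
    intro t ht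
    rcases (Set.mem_Ici.1 ht).eq_or_lt with rfl | ht
    · rw [hu0, evenEGF, tsum_eq_single 0 fun n hn => by simp [hn]]
      simp [besselCoeff]
    · rw [hut t ht, evenEGF_besselCoeff hc ht]
  have hud : ∀ t : ℝ, 0 < t → HasDerivAt u _ t := fun t ht =>
    (hd t).congr_of_eventuallyEq (hu.eventuallyEq_of_mem (Ici_mem_nhds ht))
  refine ⟨?_, fun t ht => (hud t ht).differentiableAt, fun t ht => ?_⟩
  · exact ContinuousOn.congr (fun t _ => (hd t).continuousAt.continuousWithinAt) hu
  · have hint : ∫ s in (0:ℝ)..t, u (t - s) * u s =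
        ∫ s in (0:ℝ)..t, evenEGF (besselCoeff c) (t - s) * evenEGF (besselCoeff c) s := by
      refine intervalIntegral.integral_congr fun s hs => ?_
      rw [Set.uIcc_of_le ht.le] at hs
      simp only [hu (Set.mem_Ici.2 hs.1), hu (Set.mem_Ici.2 (sub_nonneg.2 hs.2))]
    rw [(hud t ht).deriv, hint, ← (hasSum_integral_evenEGF_mul ha ht.le).tsum_eq, ← tsum_mul_left]
    congr 1
    funext n
    rw [besselCoeff_succ, mul_assoc]
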